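/- arXiv:2301.08298 — 3 statements merged into one kernel-verified Lean document; each statement's English description precedes it below -/
import Mathlib

section
/- C₀^s(S) = inf{ (2d)^s / μ(B(x,d)) : x ∈ S₀₁, d > 0 }. That is, the centred Hausdorff premeasure of the Sierpinski gasket equals the infimum of the inverse densities of closed balls centred at points of the second-generation cylinder S₀₁ = f₀(f₁(S)). -/
open MeasureTheory Metric Set
open scoped ENNReal

noncomputable section

/-- The point `(a, b)` of the Euclidean plane. -/
def pt (a b : ℝ) : EuclideanSpace ℝ (Fin 2) := (WithLp.equiv 2 (Fin 2 → ℝ)).symm ![a, b]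

/-- The translation vectors of the three similitudes. -/
def v : Fin 3 → EuclideanSpace ℝ (Fin 2)
  | 0 => pt 0 0
  | 1 => pt (1/2) 0
  | 2 => pt (1/4) (Real.sqrt 3 / 4)

/-- The three similitudes generating the Sierpinski gasket. -/
def f (i : Fin 3) (x : EuclideanSpace ℝ (Fin 2)) : EuclideanSpace ℝ (Fin 2) :=
  (1/2 : ℝ) • x + v i

/-- `fword [i₁, …, i_k] = f_{i₁} ∘ ⋯ ∘ f_{i_k}`. -/
def fword : List (Fin 3) → EuclideanSpace ℝ (Fin 2) → EuclideanSpace ℝ (Fin 2)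
  | [] => id
  | i :: l => f i ∘ fword l

/-- The similarity dimension `s = log 3 / log 2`. -/
def sDim : ℝ := Real.log 3 / Real.log 2

/-- The normalised Hausdorff measure `μ = H^s(S)⁻¹ • H^s⌊S`. -/
def muS (S : Set (EuclideanSpace ℝ (Fin 2))) : Measure (EuclideanSpace ℝ (Fin 2)) :=
  (μH[sDim] S)⁻¹ • (μH[sDim]).restrict S

/-- Fixed points `z_i = 2 v_i`. -/
def z (i : Fin 3) : EuclideanSpace ℝ (Fin 2) := (2 : ℝ) • v i

/-- The Hutchinson operator. -/
def Fop (A : Set (EuclideanSpace ℝ (Fin 2))) : Set (EuclideanSpace ℝ (Fin 2)) :=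
  f 0 '' A ∪ f 1 '' A ∪ f 2 '' A

/-- The discrete approximations `A_k = F^{k-1}(A₁)`, `A₁ = {z₀, z₁, z₂}`. -/
def Aset (k : ℕ) : Set (EuclideanSpace ℝ (Fin 2)) := Fop^[k - 1] {z 0, z 1, z 2}

/-- The discrete measures `μ_k`. -/
def muk (k : ℕ) : Measure (EuclideanSpace ℝ (Fin 2)) :=
  ((3 : ℝ≥0∞)⁻¹ ^ k) • ∑ i : Fin (k - 1) → Fin 3,
    (Measure.dirac (fword (List.ofFn i) (z 0)) + Measure.dirac (fword (List.ofFn i) (z 1)) +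
      Measure.dirac (fword (List.ofFn i) (z 2)))

/-- The centred Hausdorff premeasure `C₀^s(A)` (the limit as `δ → 0⁺` is written as a
supremum over `δ > 0`, the inner infimum being antitone in `δ`). -/
def centredPremeasure (s : ℝ) (A : Set (EuclideanSpace ℝ (Fin 2))) : ℝ≥0∞ :=
  ⨆ (δ : ℝ) (_ : 0 < δ),
    ⨅ (x : ℕ → EuclideanSpace ℝ (Fin 2)) (d : ℕ → ℝ) (_ : ∀ n, x n ∈ A)
      (_ : ∀ n, 0 ≤ d n) (_ : ∀ n, 2 * d n ≤ δ) (_ : A ⊆ ⋃ n, closedBall (x n) (d n)),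
      ∑' n, ENNReal.ofReal ((2 * d n) ^ s)

/-- The reflection across the vertical line `x₁ = 1/2`. -/
def refl2 (x : EuclideanSpace ℝ (Fin 2)) : EuclideanSpace ℝ (Fin 2) := pt (1 - x 0) (x 1)

/-- The reflection across the vertical line `x₁ = 1/4`. -/
def refl4 (x : EuclideanSpace ℝ (Fin 2)) : EuclideanSpace ℝ (Fin 2) := pt (1/2 - x 0) (x 1)

lemma sDim_pos : 0 < sDim :=
  div_pos (Real.log_pos (by norm_num)) (Real.log_pos (by norm_num))

lemma two_rpow_sDim : (2 : ℝ) ^ sDim = 3 := by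
  rw [Real.rpow_def_of_pos two_pos, sDim, mul_div_cancel₀ _ (Real.log_pos one_lt_two).ne',
    Real.exp_log three_pos]

lemma half_rpow_sDim {t : ℝ} (ht : 0 ≤ t) : (t / 2) ^ sDim = t ^ sDim / 3 := by
  rw [Real.div_rpow ht two_pos.le, two_rpow_sDim]

lemma ofReal_half_rpow_sDim {d : ℝ} (hd : 0 ≤ d) :
    ENNReal.ofReal ((2 * (d / 2)) ^ sDim) = 3⁻¹ * ENNReal.ofReal ((2 * d) ^ sDim) := by
  rw [← mul_div_assoc, half_rpow_sDim (by positivity), ENNReal.ofReal_div_of_pos three_pos,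
    ENNReal.div_eq_inv_mul]
  simp

lemma dist_f (i : Fin 3) (x y : EuclideanSpace ℝ (Fin 2)) : dist (f i x) (f i y) = dist x y / 2 := by
  simp only [f, dist_add_right, dist_smul₀, norm_div, norm_one, Real.norm_ofNat]
  ring

open scoped Pointwise in
lemma hausdorffMeasure_image_f (i : Fin 3) (A : Set (EuclideanSpace ℝ (Fin 2))) :
    μH[sDim] (f i '' A) = 3⁻¹ * μH[sDim] A := by
  have h : f i '' A = IsometryEquiv.addRight (v i) '' ((1 / 2 : ℝ) • A) := by
    rw [← Set.image_smul, Set.image_image]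
    rfl
  rw [h, IsometryEquiv.hausdorffMeasure_image,
    Measure.hausdorffMeasure_smul₀ sDim_pos.le (by norm_num)]
  have h3 : ‖(1 / 2 : ℝ)‖₊ ^ sDim = (3 : NNReal)⁻¹ := by
    ext
    rw [NNReal.coe_rpow, coe_nnnorm, norm_div, norm_one, Real.norm_ofNat, half_rpow_sDim one_pos.le,
      Real.one_rpow]
    simp
  rw [h3, ENNReal.smul_def, smul_eq_mul, ENNReal.coe_inv three_ne_zero]
  rfl

lemma image_f_subset {S : Set (EuclideanSpace ℝ (Fin 2))}
    (hSinv : S = f 0 '' S ∪ f 1 '' S ∪ f 2 '' S) (i : Fin 3) : f i '' S ⊆ S := by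
  intro y hy
  rw [hSinv]
  fin_cases i
  · exact Or.inl (Or.inl hy)
  · exact Or.inl (Or.inr hy)
  · exact Or.inr hy

lemma fword_image_subset {S : Set (EuclideanSpace ℝ (Fin 2))}
    (hSinv : S = f 0 '' S ∪ f 1 '' S ∪ f 2 '' S) (l : List (Fin 3)) : fword l '' S ⊆ S := by
  induction l with
  | nil => simp [fword]
  | cons i l ih =>
    rw [fword, Set.image_comp]
    exact (Set.image_mono ih).trans (image_f_subset hSinv i)

/-- The pieces of `S` overlap in null sets, so the measure on `S` is the sum of those on the
pieces. -/
lemma restrict_eq_sum {S : Set (EuclideanSpace ℝ (Fin 2))}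
    (hSinv : S = f 0 '' S ∪ f 1 '' S ∪ f 2 '' S) (hSfin : μH[sDim] S < ⊤) :
    (μH[sDim] : Measure (EuclideanSpace ℝ (Fin 2))).restrict S =
      ∑ i, (μH[sDim]).restrict (f i '' S) := by
  have hM : ∀ i, μH[sDim] (f i '' S) = 3⁻¹ * μH[sDim] S := fun i => hausdorffMeasure_image_f i S
  have : IsFiniteMeasure ((μH[sDim] : Measure (EuclideanSpace ℝ (Fin 2))).restrict S) :=
    isFiniteMeasure_restrict.2 hSfin.ne
  have huniv : (μH[sDim] : Measure (EuclideanSpace ℝ (Fin 2))).restrict S Set.univ =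
      (∑ i, (μH[sDim]).restrict (f i '' S) : Measure _) Set.univ := by
    simp only [Measure.finsetSum_apply, Measure.restrict_apply_univ, hM, Finset.sum_const,
      Finset.card_univ, Fintype.card_fin, nsmul_eq_mul, ← mul_assoc]
    rw [Nat.cast_ofNat, ENNReal.mul_inv_cancel (by norm_num) (by norm_num), one_mul]
  refine Measure.eq_of_le_of_measure_univ_eq ?_ huniv
  rw [Fin.sum_univ_three]
  conv_lhs => rw [hSinv]
  exact (Measure.restrict_union_le _ _).trans (add_le_add (Measure.restrict_union_le _ _) le_rfl)

/-- The cheapest ball centred in `S`, of diameter at most `δ`, covering `A`. -/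
def ballCost (S : Set (EuclideanSpace ℝ (Fin 2))) (δ : ℝ) (A : Set (EuclideanSpace ℝ (Fin 2))) :
    ℝ≥0∞ :=
  ⨅ (x : EuclideanSpace ℝ (Fin 2)) (d : ℝ) (_ : x ∈ S) (_ : 0 ≤ d) (_ : 2 * d ≤ δ)
    (_ : A ⊆ closedBall x d), ENNReal.ofReal ((2 * d) ^ sDim)

lemma ballCost_le {S A : Set (EuclideanSpace ℝ (Fin 2))} {δ d : ℝ} {x : EuclideanSpace ℝ (Fin 2)}
    (hx : x ∈ S) (hd : 0 ≤ d) (hδ : 2 * d ≤ δ) (hA : A ⊆ closedBall x d) :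
    ballCost S δ A ≤ ENNReal.ofReal ((2 * d) ^ sDim) :=
  (iInf₂_le x d).trans ((iInf₂_le hx hd).trans (iInf₂_le hδ hA))

lemma exists_of_ballCost_lt {S A : Set (EuclideanSpace ℝ (Fin 2))} {δ : ℝ} {c : ℝ≥0∞}
    (h : ballCost S δ A < c) : ∃ x d, x ∈ S ∧ 0 ≤ d ∧ 2 * d ≤ δ ∧ A ⊆ closedBall x d ∧
      ENNReal.ofReal ((2 * d) ^ sDim) < c := by
  simpa only [ballCost, iInf_lt_iff, exists_prop] using h

/-- The outer measure of economical coverings by balls centred in `S`, of diameter at most `δ`. -/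
def ballOuter (S : Set (EuclideanSpace ℝ (Fin 2))) (δ : ℝ) :
    OuterMeasure (EuclideanSpace ℝ (Fin 2)) :=
  OuterMeasure.boundedBy (ballCost S δ)

lemma ballCost_empty {S : Set (EuclideanSpace ℝ (Fin 2))} (hS : S.Nonempty) {δ : ℝ} (hδ : 0 < δ) :
    ballCost S δ ∅ = 0 := by
  obtain ⟨x, hx⟩ := hS
  simpa [Real.zero_rpow sDim_pos.ne'] using
    ballCost_le (A := ∅) (d := 0) (δ := δ) hx le_rfl (by simpa using hδ.le) (Set.empty_subset _)

lemma ballOuter_apply {S : Set (EuclideanSpace ℝ (Fin 2))} (hS : S.Nonempty) {δ : ℝ} (hδ : 0 < δ)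
    (A : Set (EuclideanSpace ℝ (Fin 2))) :
    ballOuter S δ A = ⨅ (t : ℕ → Set (EuclideanSpace ℝ (Fin 2))) (_ : A ⊆ ⋃ n, t n),
      ∑' n, ballCost S δ (t n) := by
  rw [ballOuter, OuterMeasure.boundedBy_eq_ofFunction (ballCost_empty hS hδ),
    OuterMeasure.ofFunction_apply]

lemma ballOuter_le {S A : Set (EuclideanSpace ℝ (Fin 2))} {δ d : ℝ}
    {x : EuclideanSpace ℝ (Fin 2)} (hx : x ∈ S) (hd : 0 ≤ d) (hδ : 2 * d ≤ δ)
    (hA : A ⊆ closedBall x d) : ballOuter S δ A ≤ ENNReal.ofReal ((2 * d) ^ sDim) :=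
  (OuterMeasure.boundedBy_le _).trans (ballCost_le hx hd hδ hA)

lemma ballOuter_anti (S : Set (EuclideanSpace ℝ (Fin 2))) {δ δ' : ℝ} (h : δ ≤ δ')
    (A : Set (EuclideanSpace ℝ (Fin 2))) : ballOuter S δ' A ≤ ballOuter S δ A := by
  refine OuterMeasure.le_boundedBy.2 (fun t => (OuterMeasure.boundedBy_le t).trans ?_) A
  exact le_iInf₂ fun x d => le_iInf₂ fun hx hd => le_iInf₂ fun hδ ht =>
    ballCost_le hx hd (hδ.trans h) ht

lemma ballOuter_eq_iInf {S : Set (EuclideanSpace ℝ (Fin 2))} (hS : S.Nonempty) {δ : ℝ}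
    (hδ : 0 < δ) :
    (⨅ (x : ℕ → EuclideanSpace ℝ (Fin 2)) (d : ℕ → ℝ) (_ : ∀ n, x n ∈ S)
      (_ : ∀ n, 0 ≤ d n) (_ : ∀ n, 2 * d n ≤ δ) (_ : S ⊆ ⋃ n, closedBall (x n) (d n)),
      ∑' n, ENNReal.ofReal ((2 * d n) ^ sDim)) = ballOuter S δ S := by
  rw [ballOuter_apply hS hδ]
  refine le_antisymm (le_iInf₂ fun t ht => ?_) ?_
  · refine ENNReal.le_of_forall_pos_le_add fun ε hε hfin => ?_
    obtain ⟨ε', hε', hsum⟩ := ENNReal.exists_pos_sum_of_countable (ι := ℕ)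
      (ENNReal.coe_ne_zero.2 hε.ne')
    have key : ∀ n, ∃ x d, x ∈ S ∧ 0 ≤ d ∧ 2 * d ≤ δ ∧ t n ⊆ closedBall x d ∧
        ENNReal.ofReal ((2 * d) ^ sDim) < ballCost S δ (t n) + ε' n := fun n =>
      exists_of_ballCost_lt (ENNReal.lt_add_right (ENNReal.ne_top_of_tsum_ne_top hfin.ne n)
        (ENNReal.coe_ne_zero.2 (hε' n).ne'))
    choose x d hx hd hdδ hcov hlt using key
    refine (iInf₂_le x d).trans <| (iInf₂_le hx hd).trans <|
      (iInf₂_le hdδ (ht.trans (Set.iUnion_mono hcov))).trans ?_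
    calc ∑' n, ENNReal.ofReal ((2 * d n) ^ sDim)
        ≤ ∑' n, (ballCost S δ (t n) + ε' n) := ENNReal.tsum_le_tsum fun n => (hlt n).le
      _ = ∑' n, ballCost S δ (t n) + ∑' n, (ε' n : ℝ≥0∞) := ENNReal.tsum_add
      _ ≤ _ := by gcongr
  · refine le_iInf₂ fun x d => le_iInf₂ fun hx hd => le_iInf₂ fun hδ hcov => ?_
    exact (iInf₂_le (fun n => closedBall (x n) (d n)) hcov).trans (ENNReal.tsum_le_tsum fun n =>
      ballCost_le (hx n) (hd n) (hδ n) subset_rfl)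

lemma ballCost_image_f_le {S : Set (EuclideanSpace ℝ (Fin 2))}
    (hSinv : S = f 0 '' S ∪ f 1 '' S ∪ f 2 '' S) (δ : ℝ) (i : Fin 3)
    (A : Set (EuclideanSpace ℝ (Fin 2))) :
    ballCost S (δ / 2) (f i '' A) ≤ 3⁻¹ * ballCost S δ A := by
  refine le_of_forall_gt fun c hc => ?_
  have h3 : 3 * (3 : ℝ≥0∞)⁻¹ = 1 := ENNReal.mul_inv_cancel (by norm_num) (by norm_num)
  have hc' : ballCost S δ A < 3 * c := by
    have := ENNReal.mul_lt_mul_right (a := 3) (by norm_num) (by norm_num) hc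
    rwa [← mul_assoc, h3, one_mul] at this
  obtain ⟨x, d, hx, hd, hdδ, hA, hlt⟩ := exists_of_ballCost_lt hc'
  have hsub : f i '' A ⊆ closedBall (f i x) (d / 2) := by
    rintro _ ⟨y, hy, rfl⟩
    rw [mem_closedBall, dist_f]
    have := mem_closedBall.1 (hA hy)
    linarith
  refine (ballCost_le (image_f_subset hSinv i ⟨x, hx, rfl⟩) (by positivity) (by linarith)
    hsub).trans_lt ?_
  rw [ofReal_half_rpow_sDim hd]
  calc 3⁻¹ * ENNReal.ofReal ((2 * d) ^ sDim) < 3⁻¹ * (3 * c) :=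
        ENNReal.mul_lt_mul_right (by norm_num) (by norm_num) hlt
    _ = c := by rw [← mul_assoc, mul_comm _ (3 : ℝ≥0∞), h3, one_mul]

lemma ballOuter_image_f_le {S : Set (EuclideanSpace ℝ (Fin 2))} (hS : S.Nonempty)
    (hSinv : S = f 0 '' S ∪ f 1 '' S ∪ f 2 '' S) {δ : ℝ} (hδ : 0 < δ) (i : Fin 3)
    (A : Set (EuclideanSpace ℝ (Fin 2))) :
    ballOuter S (δ / 2) (f i '' A) ≤ 3⁻¹ * ballOuter S δ A := by
  rw [ballOuter_apply hS hδ A, ENNReal.mul_iInf_of_ne (by norm_num) (by norm_num)]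
  refine le_iInf fun t => ?_
  rw [ENNReal.mul_iInf_of_ne (by norm_num) (by norm_num)]
  refine le_iInf fun ht => ?_
  rw [ballOuter_apply hS (half_pos hδ), ← ENNReal.tsum_mul_left]
  refine (iInf₂_le (fun n => f i '' t n) ?_).trans
    (ENNReal.tsum_le_tsum fun n => ballCost_image_f_le hSinv δ i (t n))
  rw [← Set.image_iUnion]
  exact Set.image_mono ht

lemma ballOuter_le_sum {S : Set (EuclideanSpace ℝ (Fin 2))} (hS : S.Nonempty)
    (hSinv : S = f 0 '' S ∪ f 1 '' S ∪ f 2 '' S) {δ : ℝ} (hδ : 0 < δ)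
    {A : Set (EuclideanSpace ℝ (Fin 2))} (hA : A ⊆ S) :
    ballOuter S (δ / 2) A ≤ ∑ i, 3⁻¹ * ballOuter S δ (S ∩ f i ⁻¹' A) := by
  have hcov : A ⊆ ⋃ i : Fin 3, f i '' (S ∩ f i ⁻¹' A) := by
    intro y hy
    have hy' := hA hy
    rw [hSinv] at hy'
    rcases hy' with (⟨x, hx, rfl⟩ | ⟨x, hx, rfl⟩) | ⟨x, hx, rfl⟩
    · exact Set.mem_iUnion.2 ⟨0, x, ⟨hx, hy⟩, rfl⟩
    · exact Set.mem_iUnion.2 ⟨1, x, ⟨hx, hy⟩, rfl⟩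
    · exact Set.mem_iUnion.2 ⟨2, x, ⟨hx, hy⟩, rfl⟩
  calc ballOuter S (δ / 2) A ≤ ballOuter S (δ / 2) (⋃ i : Fin 3, f i '' (S ∩ f i ⁻¹' A)) :=
        measure_mono hcov
    _ ≤ ∑ i, ballOuter S (δ / 2) (f i '' (S ∩ f i ⁻¹' A)) := measure_iUnion_fintype_le _ _
    _ ≤ _ := Finset.sum_le_sum fun i _ => ballOuter_image_f_le hS hSinv hδ i _

lemma ballOuter_self_half_le {S : Set (EuclideanSpace ℝ (Fin 2))} (hS : S.Nonempty)
    (hSinv : S = f 0 '' S ∪ f 1 '' S ∪ f 2 '' S) {δ : ℝ} (hδ : 0 < δ) :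
    ballOuter S (δ / 2) S ≤ ballOuter S δ S := by
  calc ballOuter S (δ / 2) S ≤ ∑ i, 3⁻¹ * ballOuter S δ (S ∩ f i ⁻¹' S) :=
        ballOuter_le_sum hS hSinv hδ subset_rfl
    _ ≤ ∑ _i : Fin 3, 3⁻¹ * ballOuter S δ S := by
        gcongr
        exact Set.inter_subset_left
    _ = ballOuter S δ S := by
        rw [Finset.sum_const, Finset.card_univ, Fintype.card_fin, nsmul_eq_mul, ← mul_assoc,
          Nat.cast_ofNat, ENNReal.mul_inv_cancel (by norm_num) (by norm_num), one_mul]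

lemma ballOuter_self_le {S : Set (EuclideanSpace ℝ (Fin 2))} (hS : S.Nonempty)
    (hSinv : S = f 0 '' S ∪ f 1 '' S ∪ f 2 '' S) {δ δ' : ℝ} (hδ : 0 < δ) (hδ' : 0 < δ') :
    ballOuter S δ S ≤ ballOuter S δ' S := by
  have h : ∀ n : ℕ, ballOuter S (δ' / 2 ^ n) S ≤ ballOuter S δ' S := by
    intro n
    induction n with
    | zero => simp
    | succ n ih =>
      rw [pow_succ, ← div_div]
      exact (ballOuter_self_half_le hS hSinv (by positivity)).trans ih
  obtain ⟨n, hn⟩ := pow_unbounded_of_one_lt (δ' / δ) one_lt_two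
  refine (ballOuter_anti S ?_ S).trans (h n)
  rw [div_lt_iff₀ hδ] at hn
  rw [div_le_iff₀ (by positivity)]
  linarith

lemma ballOuter_self_ne_top {S : Set (EuclideanSpace ℝ (Fin 2))} (hScomp : IsCompact S)
    (hS : S.Nonempty) (hSinv : S = f 0 '' S ∪ f 1 '' S ∪ f 2 '' S) {δ : ℝ} (hδ : 0 < δ) :
    ballOuter S δ S ≠ ⊤ := by
  obtain ⟨x, hx⟩ := hS
  have hsub : S ⊆ closedBall x (diam S + 1) := fun y hy =>
    mem_closedBall.2 ((dist_le_diam_of_mem hScomp.isBounded hy hx).trans (by linarith))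
  have hD : 0 ≤ diam S := diam_nonneg
  exact ((ballOuter_self_le ⟨x, hx⟩ hSinv hδ (by positivity)).trans
    (ballOuter_le hx (by positivity) le_rfl hsub)).trans_lt ENNReal.ofReal_lt_top |>.ne

/-- Covering by small cylinders: the covering cost of `A` is at most proportional to the measure
of a small neighbourhood of `A`. -/
lemma ballOuter_mul_le {S : Set (EuclideanSpace ℝ (Fin 2))} (hScomp : IsCompact S)
    (hS : S.Nonempty) (hSinv : S = f 0 '' S ∪ f 1 '' S ∪ f 2 '' S) (hSfin : μH[sDim] S < ⊤)
    {δ : ℝ} (hδ : 0 < δ) (n : ℕ) :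
    ∀ A ⊆ S, ballOuter S δ A * μH[sDim] S ≤
      ballOuter S δ S * μH[sDim] ({y | ∃ a ∈ A, dist y a ≤ diam S / 2 ^ n} ∩ S) := by
  induction n with
  | zero =>
    intro A hA
    rcases A.eq_empty_or_nonempty with rfl | ⟨a, ha⟩
    · simp
    · have hsub : S ⊆ {y | ∃ a ∈ A, dist y a ≤ diam S / 2 ^ 0} ∩ S := fun y hy =>
        ⟨⟨a, ha, by simpa using dist_le_diam_of_mem hScomp.isBounded hy (hA ha)⟩, hy⟩
      gcongr
  | succ n ih =>
    intro A hA
    have hmeas : ∀ i, MeasurableSet (f i '' S) := fun i => by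
      refine (hScomp.image ?_).measurableSet
      unfold f
      fun_prop
    set T : Set (EuclideanSpace ℝ (Fin 2)) := {y | ∃ a ∈ A, dist y a ≤ diam S / 2 ^ (n + 1)}
    have hsum : μH[sDim] (T ∩ S) = ∑ i, μH[sDim] (T ∩ f i '' S) := by
      rw [← Measure.restrict_apply' hScomp.measurableSet, restrict_eq_sum hSinv hSfin,
        Measure.finsetSum_apply]
      simp only [Measure.restrict_apply' (hmeas _)]
    have hsub : ∀ i, f i '' ({y | ∃ a ∈ S ∩ f i ⁻¹' A, dist y a ≤ diam S / 2 ^ n} ∩ S) ⊆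
        T ∩ f i '' S := by
      rintro i _ ⟨y, ⟨⟨a, ha, hya⟩, hy⟩, rfl⟩
      refine ⟨⟨f i a, ha.2, ?_⟩, y, hy, rfl⟩
      rw [dist_f, pow_succ, ← div_div]
      linarith
    calc ballOuter S δ A * μH[sDim] S
        ≤ (∑ i, 3⁻¹ * ballOuter S δ (S ∩ f i ⁻¹' A)) * μH[sDim] S := by
          gcongr
          exact (ballOuter_anti S (by linarith) A).trans (ballOuter_le_sum hS hSinv hδ hA)
      _ = ∑ i, 3⁻¹ * (ballOuter S δ (S ∩ f i ⁻¹' A) * μH[sDim] S) := by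
          rw [Finset.sum_mul]
          simp only [mul_assoc]
      _ ≤ ∑ i, 3⁻¹ * (ballOuter S δ S *
            μH[sDim] ({y | ∃ a ∈ S ∩ f i ⁻¹' A, dist y a ≤ diam S / 2 ^ n} ∩ S)) := by
          refine Finset.sum_le_sum fun i _ => ?_
          gcongr 3⁻¹ * ?_
          exact ih _ Set.inter_subset_left
      _ = ballOuter S δ S * ∑ i, μH[sDim]
            (f i '' ({y | ∃ a ∈ S ∩ f i ⁻¹' A, dist y a ≤ diam S / 2 ^ n} ∩ S)) := by
          simp only [hausdorffMeasure_image_f, Finset.mul_sum, mul_left_comm]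
      _ ≤ ballOuter S δ S * μH[sDim] (T ∩ S) := by
          rw [hsum]
          gcongr with i
          exact hsub i

lemma ballOuter_self_mul_le {S : Set (EuclideanSpace ℝ (Fin 2))} (hScomp : IsCompact S)
    (hSinv : S = f 0 '' S ∪ f 1 '' S ∪ f 2 '' S) (hSfin : μH[sDim] S < ⊤)
    {x : EuclideanSpace ℝ (Fin 2)} (hx : x ∈ S) {d : ℝ} (hd : 0 < d) {δ : ℝ} (hδ : 0 < δ) :
    ballOuter S δ S * μH[sDim] (closedBall x d ∩ S) ≤
      ENNReal.ofReal ((2 * d) ^ sDim) * μH[sDim] S := by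
  have hS : S.Nonempty := ⟨x, hx⟩
  have hfin := ballOuter_self_ne_top hScomp hS hSinv (δ := 4 * d) (by positivity)
  have key : ∀ d' ∈ Set.Ioc d (2 * d),
      ballOuter S (4 * d) S * μH[sDim] (closedBall x d ∩ S) ≤
        ENNReal.ofReal ((2 * d') ^ sDim) * μH[sDim] S := by
    rintro d' ⟨hdd', hd'⟩
    obtain ⟨n, hn⟩ := pow_unbounded_of_one_lt (diam S / (d' - d)) one_lt_two
    rw [div_lt_iff₀ (by linarith)] at hn
    have hn' : diam S / 2 ^ n < d' - d := by
      rw [div_lt_iff₀ (by positivity)]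
      linarith
    have hsub : {y | ∃ a ∈ S \ closedBall x d', dist y a ≤ diam S / 2 ^ n} ∩ S ⊆
        S \ closedBall x d := by
      rintro y ⟨⟨a, ⟨-, ha⟩, hya⟩, hy⟩
      refine ⟨hy, fun hyx => ha ?_⟩
      rw [mem_closedBall] at hyx ⊢
      have := dist_triangle a y x
      rw [dist_comm] at hya
      linarith
    have hsplit : ballOuter S (4 * d) S ≤
        ENNReal.ofReal ((2 * d') ^ sDim) + ballOuter S (4 * d) (S \ closedBall x d') := by
      calc ballOuter S (4 * d) S
          ≤ ballOuter S (4 * d) (closedBall x d' ∪ S \ closedBall x d') :=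
            measure_mono (by rw [Set.union_sdiff_self]; exact Set.subset_union_right)
        _ ≤ _ := (measure_union_le _ _).trans
            (add_le_add (ballOuter_le hx (by linarith) (by linarith) subset_rfl) le_rfl)
    have hH : μH[sDim] (closedBall x d ∩ S) + μH[sDim] (S \ closedBall x d) = μH[sDim] S := by
      rw [Set.inter_comm]
      exact measure_inter_add_sdiff S isClosed_closedBall.measurableSet
    refine (ENNReal.add_le_add_iff_right
      (a := ballOuter S (4 * d) S * μH[sDim] (S \ closedBall x d))
      (ENNReal.mul_ne_top hfin ((measure_mono Set.sdiff_subset).trans_lt hSfin).ne)).1 ?_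
    calc _ = ballOuter S (4 * d) S * μH[sDim] S := by rw [← mul_add, hH]
      _ ≤ (ENNReal.ofReal ((2 * d') ^ sDim) + ballOuter S (4 * d) (S \ closedBall x d')) *
          μH[sDim] S := by gcongr
      _ = ENNReal.ofReal ((2 * d') ^ sDim) * μH[sDim] S +
          ballOuter S (4 * d) (S \ closedBall x d') * μH[sDim] S := add_mul _ _ _
      _ ≤ _ := by
        refine add_le_add le_rfl ((ballOuter_mul_le hScomp hS hSinv hSfin (by positivity) n _
          Set.sdiff_subset).trans ?_)
        gcongr
  have hlim : Filter.Tendsto (fun d' : ℝ => ENNReal.ofReal ((2 * d') ^ sDim) * μH[sDim] S)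
      (nhdsWithin d (Set.Ioi d)) (nhds (ENNReal.ofReal ((2 * d) ^ sDim) * μH[sDim] S)) := by
    refine Filter.Tendsto.mono_left ?_ nhdsWithin_le_nhds
    refine ENNReal.Tendsto.mul_const (ENNReal.tendsto_ofReal ?_) (Or.inr hSfin.ne)
    exact ((continuous_const.mul continuous_id).rpow_const
      fun _ => Or.inr sDim_pos.le).tendsto d
  calc _ ≤ ballOuter S (4 * d) S * μH[sDim] (closedBall x d ∩ S) := by
        gcongr ?_ * _
        exact ballOuter_self_le hS hSinv hδ (by positivity)
    _ ≤ _ := ge_of_tendsto hlim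
      (Filter.mem_of_superset (Ioc_mem_nhdsGT (by linarith)) key)

lemma muS_apply {S : Set (EuclideanSpace ℝ (Fin 2))} (hScomp : IsCompact S)
    (A : Set (EuclideanSpace ℝ (Fin 2))) :
    muS S A = (μH[sDim] S)⁻¹ * μH[sDim] (A ∩ S) := by
  rw [muS, Measure.smul_apply, Measure.restrict_apply' hScomp.measurableSet, smul_eq_mul]

lemma muS_self {S : Set (EuclideanSpace ℝ (Fin 2))} (hScomp : IsCompact S)
    (hSpos : 0 < μH[sDim] S) (hSfin : μH[sDim] S < ⊤) : muS S S = 1 := by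
  rw [muS_apply hScomp, Set.inter_self, ENNReal.inv_mul_cancel hSpos.ne' hSfin.ne]

lemma muS_singleton {S : Set (EuclideanSpace ℝ (Fin 2))} (hScomp : IsCompact S)
    (x : EuclideanSpace ℝ (Fin 2)) : muS S {x} = 0 := by
  have := Measure.nullSingletonClass_hausdorff (EuclideanSpace ℝ (Fin 2)) sDim_pos
  rw [muS_apply hScomp, measure_mono_null Set.inter_subset_left (measure_singleton x), mul_zero]

lemma muS_closedBall_f_ge {S : Set (EuclideanSpace ℝ (Fin 2))} (hScomp : IsCompact S)
    (hSinv : S = f 0 '' S ∪ f 1 '' S ∪ f 2 '' S) (i : Fin 3) (x : EuclideanSpace ℝ (Fin 2))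
    (d : ℝ) : 3⁻¹ * muS S (closedBall x d) ≤ muS S (closedBall (f i x) (d / 2)) := by
  have hsub : f i '' (closedBall x d ∩ S) ⊆ closedBall (f i x) (d / 2) ∩ S := by
    rintro _ ⟨y, ⟨hy, hyS⟩, rfl⟩
    refine ⟨?_, image_f_subset hSinv i ⟨y, hyS, rfl⟩⟩
    rw [mem_closedBall] at hy ⊢
    rw [dist_f]
    linarith
  rw [muS_apply hScomp, muS_apply hScomp, mul_left_comm, ← hausdorffMeasure_image_f i]
  gcongr

/-- Passing to a similar ball in a smaller piece does not increase the inverse density. -/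
lemma inverse_density_f_le {S : Set (EuclideanSpace ℝ (Fin 2))} (hScomp : IsCompact S)
    (hSinv : S = f 0 '' S ∪ f 1 '' S ∪ f 2 '' S) (i : Fin 3) (x : EuclideanSpace ℝ (Fin 2))
    {d : ℝ} (hd : 0 ≤ d) :
    ENNReal.ofReal ((2 * (d / 2)) ^ sDim) / muS S (closedBall (f i x) (d / 2)) ≤
      ENNReal.ofReal ((2 * d) ^ sDim) / muS S (closedBall x d) := by
  rw [ofReal_half_rpow_sDim hd]
  refine (ENNReal.div_le_div_left (muS_closedBall_f_ge hScomp hSinv i x d) _).trans_eq ?_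
  exact ENNReal.mul_div_mul_left _ _ (by norm_num) (by norm_num)

theorem statement3 (S : Set (EuclideanSpace ℝ (Fin 2))) (hScomp : IsCompact S) (hSne : S.Nonempty)
    (hSinv : S = f 0 '' S ∪ f 1 '' S ∪ f 2 '' S)
    (hSpos : 0 < μH[sDim] S) (hSfin : μH[sDim] S < ⊤) :
    centredPremeasure sDim S =
      ⨅ (x : EuclideanSpace ℝ (Fin 2)) (_ : x ∈ fword [0, 1] '' S) (d : ℝ) (_ : 0 < d),
        ENNReal.ofReal ((2 * d) ^ sDim) / muS S (closedBall x d) := by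
  apply le_antisymm
  · refine iSup₂_le fun δ hδ => ?_
    rw [ballOuter_eq_iInf hSne hδ]
    refine le_iInf₂ fun x hx => le_iInf₂ fun d hd => ?_
    have hpos : ENNReal.ofReal ((2 * d) ^ sDim) ≠ 0 :=
      (ENNReal.ofReal_pos.2 (Real.rpow_pos_of_pos (by positivity) _)).ne'
    rw [ENNReal.le_div_iff_mul_le (Or.inr hpos) (Or.inr ENNReal.ofReal_ne_top), muS_apply hScomp,
      mul_left_comm, ← ENNReal.div_eq_inv_mul]
    exact ENNReal.div_le_of_le_mul (ballOuter_self_mul_le hScomp hSinv hSfin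
      (fword_image_subset hSinv _ hx) hd hδ)
  · refine le_trans ?_ (le_iSup₂ (1 : ℝ) one_pos)
    refine le_iInf₂ fun x d => le_iInf₂ fun hx hd => le_iInf₂ fun _ hcov => ?_
    set q : ℝ≥0∞ := ⨅ (x : EuclideanSpace ℝ (Fin 2)) (_ : x ∈ fword [0, 1] '' S) (d : ℝ)
      (_ : 0 < d), ENNReal.ofReal ((2 * d) ^ sDim) / muS S (closedBall x d) with hq
    have hball : ∀ n, q * muS S (closedBall (x n) (d n)) ≤ ENNReal.ofReal ((2 * d n) ^ sDim) := by
      intro n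
      rcases (hd n).eq_or_lt with h0 | h0
      · rw [← h0, closedBall_zero, muS_singleton hScomp, mul_zero]
        exact zero_le
      · refine ENNReal.mul_le_of_le_div ?_
        refine (iInf₂_le (fword [0, 1] (x n)) ⟨x n, hx n, rfl⟩).trans <|
          (iInf₂_le (d n / 2 / 2) (by positivity)).trans ?_
        exact (inverse_density_f_le hScomp hSinv 0 _ (by positivity)).trans
          (inverse_density_f_le hScomp hSinv 1 _ h0.le)
    calc q = q * muS S S := by rw [muS_self hScomp hSpos hSfin, mul_one]
      _ ≤ q * ∑' n, muS S (closedBall (x n) (d n)) := by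
          gcongr
          exact (measure_mono hcov).trans (measure_iUnion_le _)
      _ = ∑' n, q * muS S (closedBall (x n) (d n)) := ENNReal.tsum_mul_left.symm
      _ ≤ _ := ENNReal.tsum_le_tsum hball

end
end

section
/- Let π₄(x₁,x₂) := (1/2 − x₁, x₂) be the reflection of the plane across the vertical line x₁ = 1/4. For every x ∈ S₀₀ = f₀(f₀(S)) and every d > 0, μ(B(x,d)) ≤ μ(B(π₄(x), d)). -/
open MeasureTheory Metric Set
open scoped ENNReal

noncomputable section

@[simp] lemma pt_apply_zero (a b : ℝ) : pt a b 0 = a := rfl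

@[simp] lemma pt_apply_one (a b : ℝ) : pt a b 1 = b := rfl

lemma plane_ext {x y : EuclideanSpace ℝ (Fin 2)} (h0 : x 0 = y 0) (h1 : x 1 = y 1) : x = y := by
  ext i
  fin_cases i
  · exact h0
  · exact h1

lemma dist_le_dist_iff_sq {a b c e : EuclideanSpace ℝ (Fin 2)} :
    dist a b ≤ dist c e ↔
      (a 0 - b 0) ^ 2 + (a 1 - b 1) ^ 2 ≤ (c 0 - e 0) ^ 2 + (c 1 - e 1) ^ 2 := by
  rw [EuclideanSpace.dist_eq, EuclideanSpace.dist_eq, Real.sqrt_le_sqrt_iff (by positivity)]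
  simp [Fin.sum_univ_two, Real.dist_eq, sq_abs]

lemma f_apply_zero (i : Fin 3) (x : EuclideanSpace ℝ (Fin 2)) : f i x 0 = x 0 / 2 + v i 0 := by
  simp [f]; ring

lemma f_apply_one (i : Fin 3) (x : EuclideanSpace ℝ (Fin 2)) : f i x 1 = x 1 / 2 + v i 1 := by
  simp [f]; ring

lemma isometry_refl2 : Isometry refl2 := by
  refine Isometry.of_dist_eq fun x y => le_antisymm ?_ ?_ <;> rw [dist_le_dist_iff_sq] <;>
    simp only [refl2, pt_apply_zero, pt_apply_one] <;> apply le_of_eq <;> ring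

lemma isometry_refl4 : Isometry refl4 := by
  refine Isometry.of_dist_eq fun x y => le_antisymm ?_ ?_ <;> rw [dist_le_dist_iff_sq] <;>
    simp only [refl4, pt_apply_zero, pt_apply_one] <;> apply le_of_eq <;> ring

lemma involutive_refl2 : Function.Involutive refl2 := fun x => by
  apply plane_ext <;> simp [refl2]

lemma involutive_refl4 : Function.Involutive refl4 := fun x => by
  apply plane_ext <;> simp [refl4]

lemma refl2_f_zero (x : EuclideanSpace ℝ (Fin 2)) : refl2 (f 0 x) = f 1 (refl2 x) := by
  apply plane_ext <;> simp [refl2, f_apply_zero, f_apply_one, v]; ring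

lemma refl2_f_one (x : EuclideanSpace ℝ (Fin 2)) : refl2 (f 1 x) = f 0 (refl2 x) := by
  apply plane_ext <;> simp [refl2, f_apply_zero, f_apply_one, v]; ring

lemma refl2_f_two (x : EuclideanSpace ℝ (Fin 2)) : refl2 (f 2 x) = f 2 (refl2 x) := by
  apply plane_ext <;> simp [refl2, f_apply_zero, f_apply_one, v]; ring

lemma refl4_f_zero (x : EuclideanSpace ℝ (Fin 2)) : refl4 (f 0 x) = f 0 (refl2 x) := by
  apply plane_ext <;> simp [refl2, refl4, f_apply_zero, f_apply_one, v]; ring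

/-- A compact set covered by its images under the `f i` lies in every nonempty closed set that the
`f i` map into itself. -/
lemma subset_of_forall_exists_f {S T : Set (EuclideanSpace ℝ (Fin 2))} (hS : IsCompact S)
    (hSf : ∀ y ∈ S, ∃ i, ∃ y' ∈ S, y = f i y') (hT : IsClosed T) (hTne : T.Nonempty)
    (hTf : ∀ i, ∀ t ∈ T, f i t ∈ T) : S ⊆ T := by
  rcases S.eq_empty_or_nonempty with rfl | hSne
  · exact empty_subset _
  obtain ⟨y, hy, hmax⟩ := hS.exists_isMaxOn hSne (continuous_infDist_pt T).continuousOn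
  obtain ⟨i, y', hy', rfl⟩ := hSf y hy
  have hle : 2 * infDist (f i y') T ≤ infDist y' T := by
    refine (le_infDist hTne).2 fun t ht => ?_
    have h := infDist_le_dist_of_mem (x := f i y') (hTf i t ht)
    rw [dist_f] at h
    linarith
  have hmax' : ∀ w ∈ S, infDist w T ≤ infDist (f i y') T := fun w hw => hmax hw
  intro w hw
  rw [hT.mem_iff_infDist_zero hTne]
  linarith [hmax' w hw, hmax' y' hy', infDist_nonneg (x := w) (s := T)]

section Gasket

variable {S : Set (EuclideanSpace ℝ (Fin 2))}

lemma exists_f_of_mem (hSinv : S = f 0 '' S ∪ f 1 '' S ∪ f 2 '' S) :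
    ∀ y ∈ S, ∃ i, ∃ y' ∈ S, y = f i y' := by
  intro y hy
  rw [hSinv] at hy
  rcases hy with (⟨y', h, rfl⟩ | ⟨y', h, rfl⟩) | ⟨y', h, rfl⟩
  exacts [⟨0, y', h, rfl⟩, ⟨1, y', h, rfl⟩, ⟨2, y', h, rfl⟩]

lemma f_mem (hSinv : S = f 0 '' S ∪ f 1 '' S ∪ f 2 '' S) (i : Fin 3)
    {y : EuclideanSpace ℝ (Fin 2)} (hy : y ∈ S) : f i y ∈ S := by
  rw [hSinv]
  fin_cases i
  exacts [.inl (.inl ⟨y, hy, rfl⟩), .inl (.inr ⟨y, hy, rfl⟩), .inr ⟨y, hy, rfl⟩]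

lemma refl2_mem (hScomp : IsCompact S) (hSinv : S = f 0 '' S ∪ f 1 '' S ∪ f 2 '' S)
    {y : EuclideanSpace ℝ (Fin 2)} (hy : y ∈ S) : refl2 y ∈ S := by
  have hsub : S ⊆ refl2 ⁻¹' S := by
    refine subset_of_forall_exists_f hScomp (exists_f_of_mem hSinv)
      (hScomp.isClosed.preimage isometry_refl2.continuous) ⟨refl2 y, ?_⟩ fun i t ht => ?_
    · rwa [mem_preimage, involutive_refl2 y]
    · rw [mem_preimage] at ht ⊢
      fin_cases i
      · exact refl2_f_zero t ▸ f_mem hSinv 1 ht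
      · exact refl2_f_one t ▸ f_mem hSinv 0 ht
      · exact refl2_f_two t ▸ f_mem hSinv 2 ht
  exact hsub hy

lemma apply_zero_nonneg (hScomp : IsCompact S) (hSinv : S = f 0 '' S ∪ f 1 '' S ∪ f 2 '' S)
    {y : EuclideanSpace ℝ (Fin 2)} (hy : y ∈ S) : 0 ≤ y 0 := by
  have hsub : S ⊆ {w | 0 ≤ w 0} := by
    refine subset_of_forall_exists_f hScomp (exists_f_of_mem hSinv)
      (isClosed_le continuous_const (by fun_prop)) ⟨0, by simp⟩ fun i t ht => ?_
    rw [mem_ofPred_eq] at ht ⊢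
    rw [f_apply_zero]
    fin_cases i <;> simp [v] <;> linarith
  exact hsub hy

lemma apply_zero_le_one (hScomp : IsCompact S) (hSinv : S = f 0 '' S ∪ f 1 '' S ∪ f 2 '' S)
    {y : EuclideanSpace ℝ (Fin 2)} (hy : y ∈ S) : y 0 ≤ 1 := by
  have h := apply_zero_nonneg hScomp hSinv (refl2_mem hScomp hSinv hy)
  simpa [refl2] using h

lemma refl4_image_f_zero (hScomp : IsCompact S) (hSinv : S = f 0 '' S ∪ f 1 '' S ∪ f 2 '' S) :
    refl4 '' (f 0 '' S) = f 0 '' S := by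
  have hsub : ∀ w ∈ f 0 '' S, refl4 w ∈ f 0 '' S := by
    rintro _ ⟨y, hy, rfl⟩
    exact ⟨refl2 y, refl2_mem hScomp hSinv hy, (refl4_f_zero y).symm⟩
  refine Subset.antisymm (image_subset_iff.2 hsub) fun w hw => ?_
  exact ⟨refl4 w, hsub w hw, involutive_refl4 w⟩

lemma quarter_le_apply_zero (hScomp : IsCompact S)
    (hSinv : S = f 0 '' S ∪ f 1 '' S ∪ f 2 '' S) {y : EuclideanSpace ℝ (Fin 2)}
    (hy : y ∈ S \ f 0 '' S) : 1 / 4 ≤ y 0 := by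
  have h := hy.1
  rw [hSinv] at h
  rcases h with (h | ⟨w, hw, rfl⟩) | ⟨w, hw, rfl⟩
  · exact absurd h hy.2
  all_goals
    have := apply_zero_nonneg hScomp hSinv hw
    rw [f_apply_zero]
    norm_num [v]
    linarith

end Gasket

lemma dist_refl4_le {x y : EuclideanSpace ℝ (Fin 2)} (hx : x 0 ≤ 1 / 4) (hy : 1 / 4 ≤ y 0) :
    dist y (refl4 x) ≤ dist y x := by
  rw [dist_le_dist_iff_sq]
  simp only [refl4, pt_apply_zero, pt_apply_one]
  nlinarith [mul_nonneg (sub_nonneg.2 hx) (sub_nonneg.2 hy)]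

theorem statement5 (S : Set (EuclideanSpace ℝ (Fin 2))) (hScomp : IsCompact S) (hSne : S.Nonempty)
    (hSinv : S = f 0 '' S ∪ f 1 '' S ∪ f 2 '' S)
    (hSpos : 0 < μH[sDim] S) (hSfin : μH[sDim] S < ⊤)
    (x : EuclideanSpace ℝ (Fin 2)) (hx : x ∈ fword [0, 0] '' S) (d : ℝ) (hd : 0 < d) :
    muS S (closedBall x d) ≤ muS S (closedBall (refl4 x) d) := by
  have hx4 : x 0 ≤ 1 / 4 := by
    obtain ⟨y, hy, rfl⟩ := hx
    have := apply_zero_le_one hScomp hSinv hy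
    simp only [fword, Function.comp_apply, id, f_apply_zero]
    norm_num [v]
    linarith
  have hS0 : f 0 '' S ⊆ S := image_subset_iff.2 fun y hy => f_mem hSinv 0 hy
  have hmeas : MeasurableSet (f 0 '' S) :=
    (hScomp.image (by unfold f; fun_prop)).isClosed.measurableSet
  have hsplit : ∀ w, μH[sDim] (closedBall w d ∩ S) =
      μH[sDim] (closedBall w d ∩ f 0 '' S) + μH[sDim] (closedBall w d ∩ (S \ f 0 '' S)) := by
    intro w
    rw [← measure_inter_add_sdiff (closedBall w d ∩ S) hmeas, inter_assoc,
      inter_eq_self_of_subset_right hS0, inter_sdiff_assoc]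
  have hrefl : μH[sDim] (closedBall x d ∩ f 0 '' S) =
      μH[sDim] (closedBall (refl4 x) d ∩ f 0 '' S) := by
    rw [← isometry_refl4.hausdorffMeasure_image (.inr involutive_refl4.surjective)
      (closedBall x d ∩ f 0 '' S), image_inter involutive_refl4.injective,
      refl4_image_f_zero hScomp hSinv]
    congr 2
    ext w
    rw [involutive_refl4.image_eq_preimage_symm, mem_preimage, mem_closedBall, mem_closedBall,
      ← isometry_refl4.dist_eq, involutive_refl4 w]
  have hrest : closedBall x d ∩ (S \ f 0 '' S) ⊆ closedBall (refl4 x) d ∩ (S \ f 0 '' S) :=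
    fun y hy => ⟨(dist_refl4_le hx4 (quarter_le_apply_zero hScomp hSinv hy.2)).trans hy.1, hy.2⟩
  simp only [muS, Measure.smul_apply, smul_eq_mul,
    Measure.restrict_apply measurableSet_closedBall]
  rw [hsplit, hsplit, hrefl]
  gcongr

end
end

section
/- For every k ≥ 2, each point x ∈ A_k \ A₁ has exactly two codes of length k, i.e. there are exactly two pairs (i, j) with i ∈ {0,1,2}^{k−1} and j ∈ {0,1,2} such that x = f_i(z_j); and each point x ∈ A₁ has exactly one such pair. -/
open MeasureTheory Metric Set
open scoped ENNReal

noncomputable section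

/-- The barycentric coordinates with respect to the triangle `z 0`, `z 1`, `z 2`. -/
def bary (x : EuclideanSpace ℝ (Fin 2)) : Fin 3 → ℝ
  | 0 => 1 - x 0 - x 1 * Real.sqrt 3 / 3
  | 1 => x 0 - x 1 * Real.sqrt 3 / 3
  | 2 => 2 * x 1 * Real.sqrt 3 / 3

lemma bary_sum (x : EuclideanSpace ℝ (Fin 2)) : bary x 0 + bary x 1 + bary x 2 = 1 := by
  simp only [bary]; ring

lemma bary_injective : Function.Injective bary := by
  intro x y h
  have h1 := congrFun h 1
  have h2 := congrFun h 2
  have hs : 0 < Real.sqrt 3 := by positivity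
  simp only [bary] at h1 h2
  have e : x 1 = y 1 := by
    apply mul_right_cancel₀ hs.ne'
    linarith
  rw [e] at h1
  ext i
  fin_cases i
  · simpa using h1
  · exact e

lemma bary_z (i j : Fin 3) : bary (z i) j = if i = j then 1 else 0 := by
  have hs : Real.sqrt 3 * Real.sqrt 3 = 3 := Real.mul_self_sqrt (by norm_num)
  fin_cases i <;> fin_cases j <;> simp [bary, z, v, pt] <;> linarith

lemma bary_two_smul_sub_z (x : EuclideanSpace ℝ (Fin 2)) (i j : Fin 3) :
    bary ((2 : ℝ) • x - z i) j = 2 * bary x j - if i = j then 1 else 0 := by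
  rw [← bary_z]
  fin_cases j <;> simp [bary] <;> ring

lemma eq_z_of_one_le_bary {x : EuclideanSpace ℝ (Fin 2)} {j : Fin 3}
    (hx : ∀ l, 0 ≤ bary x l) (hj : 1 ≤ bary x j) : x = z j := by
  apply bary_injective
  funext l
  rw [bary_z]
  have h0 := hx 0
  have h1 := hx 1
  have h2 := hx 2
  have hs := bary_sum x
  fin_cases j <;> fin_cases l <;> simp at hj ⊢ <;> linarith

lemma f_eq_iff (i : Fin 3) (x y : EuclideanSpace ℝ (Fin 2)) :
    f i y = x ↔ y = (2 : ℝ) • x - z i := by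
  simp only [f, z]
  constructor
  · rintro rfl
    module
  · rintro rfl
    module

open Classical in
/-- The number of codes of `x` consisting of a word of length `n` and a vertex. -/
def codeCount (n : ℕ) (x : EuclideanSpace ℝ (Fin 2)) : ℕ :=
  ∑ w : Fin n → Fin 3, ∑ j : Fin 3, if fword (List.ofFn w) (z j) = x then 1 else 0

lemma ncard_codes (n : ℕ) (x : EuclideanSpace ℝ (Fin 2)) :
    {p : (Fin n → Fin 3) × Fin 3 | fword (List.ofFn p.1) (z p.2) = x}.ncard = codeCount n x := by
  classical
  rw [Set.ncard_eq_toFinset_card', Set.toFinset_ofPred, Finset.card_filter,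
    Fintype.sum_prod_type, codeCount]

open Classical in
lemma codeCount_zero (x : EuclideanSpace ℝ (Fin 2)) :
    codeCount 0 x = ∑ j : Fin 3, if z j = x then 1 else 0 := by
  simp [codeCount, fword]

lemma codeCount_succ (n : ℕ) (x : EuclideanSpace ℝ (Fin 2)) :
    codeCount (n + 1) x = ∑ i : Fin 3, codeCount n ((2 : ℝ) • x - z i) := by
  classical
  simp only [codeCount]
  rw [← (Fin.consEquiv fun _ : Fin (n + 1) => Fin 3).sum_comp, Fintype.sum_prod_type]
  simp [Fin.consEquiv, List.ofFn_succ, fword, f_eq_iff]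

lemma bary_nonneg_of_codeCount_ne_zero {n : ℕ} {x : EuclideanSpace ℝ (Fin 2)}
    (h : codeCount n x ≠ 0) (j : Fin 3) : 0 ≤ bary x j := by
  classical
  induction n generalizing x with
  | zero =>
    rw [codeCount_zero] at h
    obtain ⟨i, -, hi⟩ := Finset.exists_ne_zero_of_sum_ne_zero h
    have hx : z i = x := by simpa using hi
    rw [← hx, bary_z]
    split_ifs <;> norm_num
  | succ n ih =>
    rw [codeCount_succ] at h
    obtain ⟨i, -, hi⟩ := Finset.exists_ne_zero_of_sum_ne_zero h
    have := ih hi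
    rw [bary_two_smul_sub_z] at this
    split_ifs at this <;> linarith

lemma codeCount_eq_zero {n : ℕ} {x : EuclideanSpace ℝ (Fin 2)} {j : Fin 3}
    (h : bary x j < 0) : codeCount n x = 0 := by
  by_contra h'
  exact h.not_ge (bary_nonneg_of_codeCount_ne_zero h' j)

lemma z_injective : Function.Injective z := by
  intro i j h
  by_contra hij
  have := congrFun (congrArg bary h) j
  simp [bary_z, hij] at this

lemma codeCount_z (n : ℕ) (i : Fin 3) : codeCount n (z i) = 1 := by
  induction n with
  | zero => simp [codeCount_zero, z_injective.eq_iff]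
  | succ n ih =>
    rw [codeCount_succ, Fintype.sum_eq_single i, two_smul, add_sub_cancel_right, ih]
    intro j hj
    apply codeCount_eq_zero (j := j)
    rw [bary_two_smul_sub_z, bary_z]
    simp [hj.symm]

lemma codeCount_eq_two {n : ℕ} {x : EuclideanSpace ℝ (Fin 2)} (hx : ∀ i, x ≠ z i)
    (h : codeCount n x ≠ 0) : codeCount n x = 2 := by
  induction n generalizing x with
  | zero =>
    classical
    simp [codeCount_zero, fun i => (hx i).symm] at h
  | succ n ih =>
    rw [codeCount_succ] at h ⊢
    obtain ⟨i, -, hi⟩ := Finset.exists_ne_zero_of_sum_ne_zero h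
    by_cases hz : ∃ j, (2 : ℝ) • x - z i = z j
    · obtain ⟨j, hj⟩ := hz
      have hij : i ≠ j := by
        rintro rfl
        exact hx i (((f_eq_iff i x (z i)).2 hj.symm).symm.trans
          ((f_eq_iff i (z i) (z i)).2 (by module)))
      have hji : (2 : ℝ) • x - z j = z i := by rw [← hj]; abel
      rw [Fintype.sum_eq_add i j hij, hj, hji, codeCount_z, codeCount_z]
      rintro l ⟨hli, hlj⟩
      apply codeCount_eq_zero (j := l)
      have hb := congrFun (congrArg bary hj) l
      simp only [bary_two_smul_sub_z, bary_z, hli.symm, hlj.symm, if_false] at hb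
      rw [bary_two_smul_sub_z, if_pos rfl]
      linarith
    · push Not at hz
      rw [Fintype.sum_eq_single i, ih hz hi]
      intro j hj
      by_contra hne
      have hb := bary_nonneg_of_codeCount_ne_zero hne j
      rw [bary_two_smul_sub_z, if_pos rfl] at hb
      refine hz j (eq_z_of_one_le_bary (bary_nonneg_of_codeCount_ne_zero hi) ?_)
      rw [bary_two_smul_sub_z, if_neg hj.symm]
      linarith

lemma mem_Fop {A : Set (EuclideanSpace ℝ (Fin 2))} {x : EuclideanSpace ℝ (Fin 2)} :
    x ∈ Fop A ↔ ∃ i, (2 : ℝ) • x - z i ∈ A := by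
  simp [Fop, Fin.exists_fin_succ, f_eq_iff, or_assoc]

lemma mem_vertices {x : EuclideanSpace ℝ (Fin 2)} :
    x ∈ ({z 0, z 1, z 2} : Set (EuclideanSpace ℝ (Fin 2))) ↔ ∃ i, x = z i := by
  simp [Fin.exists_fin_succ]

lemma codeCount_ne_zero_of_mem_iterate {n : ℕ} {x : EuclideanSpace ℝ (Fin 2)}
    (h : x ∈ Fop^[n] {z 0, z 1, z 2}) : codeCount n x ≠ 0 := by
  induction n generalizing x with
  | zero =>
    obtain ⟨i, rfl⟩ := mem_vertices.1 h
    simp [codeCount_z]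
  | succ n ih =>
    rw [Function.iterate_succ_apply', mem_Fop] at h
    obtain ⟨i, hi⟩ := h
    rw [codeCount_succ]
    exact fun h0 => ih hi (Finset.sum_eq_zero_iff.1 h0 i (Finset.mem_univ i))

theorem statement11 (k : ℕ) (hk : 2 ≤ k) :
    (∀ x ∈ Aset k \ Aset 1,
        {p : (Fin (k - 1) → Fin 3) × Fin 3 | fword (List.ofFn p.1) (z p.2) = x}.ncard = 2) ∧
      ∀ x ∈ Aset 1,
        {p : (Fin (k - 1) → Fin 3) × Fin 3 | fword (List.ofFn p.1) (z p.2) = x}.ncard = 1 := by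
  simp only [ncard_codes]
  refine ⟨fun x hx => codeCount_eq_two (fun i hi => hx.2 ?_)
    (codeCount_ne_zero_of_mem_iterate hx.1), fun x hx => ?_⟩
  · exact mem_vertices.2 ⟨i, hi⟩
  · obtain ⟨i, rfl⟩ := mem_vertices.1 hx
    exact codeCount_z _ i

end
end
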